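/- arXiv:2504.21333 — 2 statements merged into one kernel-verified Lean document; each statement's English description precedes it below -/
import Mathlib

section
/- Suppose H ≥ 1 and N ≥ 1 are real, α and β are real numbers, and a, q are integers with q ≥ 1, gcd(a,q) = 1 and |α − a/q| < 1/q². Then for every ε > 0, Σ_{n ≤ N} min(1, 1/(H‖αn² + β‖)) ≪_ε (NHq)^ε ( N q^{−1/2} + N^{1/2} + N H^{−1} + H^{−1/2} q^{1/2} ), where the sum is over positive integers n ≤ N. -/
/-- `nint x` is the distance from the real number `x` to the nearest integer. -/
noncomputable def nint (x : ℝ) : ℝ := |x - round x|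

open Finset

lemma card_divisors_le_mul_rpow {ε : ℝ} (hε : 0 < ε) :
    ∃ C : ℝ, 1 ≤ C ∧ ∀ n : ℕ, n ≠ 0 → (#n.divisors : ℝ) ≤ C * (n : ℝ) ^ ε := by
  have hl : 0 < ε * Real.log 2 := mul_pos hε (Real.log_pos (by norm_num))
  set C₀ : ℝ := 1 + 1 / (ε * Real.log 2) with hC₀
  have hC₀1 : 1 ≤ C₀ := by
    have : 0 < 1 / (ε * Real.log 2) := by positivity
    linarith
  obtain ⟨P, hP⟩ := exists_nat_ge ((2 : ℝ) ^ (1 / ε))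
  refine ⟨C₀ ^ P, one_le_pow₀ hC₀1, fun n hn => ?_⟩
  have hsmall : ∀ p a : ℕ, 2 ≤ p → (a + 1 : ℝ) ≤ C₀ * ((p : ℝ) ^ a) ^ ε := by
    intro p a hp
    have hp' : (2 : ℝ) ≤ p := by exact_mod_cast hp
    have h1 : ((2 : ℝ) ^ a) ^ ε ≤ ((p : ℝ) ^ a) ^ ε := by gcongr
    have h2 : 1 + a * (ε * Real.log 2) ≤ ((2 : ℝ) ^ a) ^ ε := by
      rw [Real.rpow_def_of_pos (by positivity), Real.log_pow]
      have := Real.add_one_le_exp ((a : ℝ) * Real.log 2 * ε)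
      linarith
    have h3 : (a + 1 : ℝ) ≤ C₀ * (1 + a * (ε * Real.log 2)) := by
      have h4 : 1 / (ε * Real.log 2) * (a * (ε * Real.log 2)) = a := by
        field_simp
      have h5 : 0 < 1 / (ε * Real.log 2) := by positivity
      have h6 : 0 ≤ a * (ε * Real.log 2) := by positivity
      rw [hC₀]
      nlinarith
    exact h3.trans (by gcongr; exact h2.trans h1)
  have hlarge : ∀ p a : ℕ, P ≤ p → (a + 1 : ℝ) ≤ ((p : ℝ) ^ a) ^ ε := by
    intro p a hp
    have hp' : (2 : ℝ) ^ (1 / ε) ≤ p := hP.trans (by exact_mod_cast hp)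
    have h1 : (2 : ℝ) ≤ (p : ℝ) ^ ε := by
      calc (2 : ℝ) = ((2 : ℝ) ^ (1 / ε)) ^ ε := by
            rw [← Real.rpow_mul (by norm_num), one_div_mul_cancel hε.ne', Real.rpow_one]
        _ ≤ _ := by gcongr
    have h2 : ((p : ℝ) ^ a) ^ ε = ((p : ℝ) ^ ε) ^ a := by
      rw [← Real.rpow_natCast, ← Real.rpow_natCast, ← Real.rpow_mul (by positivity),
        ← Real.rpow_mul (by positivity), mul_comm]
    rw [h2]
    calc (a + 1 : ℝ) ≤ 2 ^ a := by exact_mod_cast Nat.lt_two_pow_self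
      _ ≤ _ := by gcongr
  have hn' : (n : ℝ) ^ ε = ∏ p ∈ n.primeFactors, ((p : ℝ) ^ n.factorization p) ^ ε := by
    rw [Real.finsetProd_rpow _ _ (fun i _ => by positivity)]
    congr 1
    exact_mod_cast (Nat.prod_factorization_pow_eq_self hn).symm
  rw [Nat.card_divisors hn, hn']
  push_cast
  calc ∏ p ∈ n.primeFactors, ((n.factorization p : ℝ) + 1)
      ≤ ∏ p ∈ n.primeFactors,
          ((if p < P then C₀ else 1) * ((p : ℝ) ^ n.factorization p) ^ ε) := by
        refine prod_le_prod (fun i _ => by positivity) fun p hp => ?_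
        split_ifs with h
        · exact hsmall p _ (Nat.prime_of_mem_primeFactors hp).two_le
        · rw [one_mul]
          exact hlarge p _ (not_lt.1 h)
    _ = C₀ ^ #{p ∈ n.primeFactors | p < P} *
          ∏ p ∈ n.primeFactors, ((p : ℝ) ^ n.factorization p) ^ ε := by
        rw [prod_mul_distrib, prod_ite]
        simp
    _ ≤ _ := by
        gcongr
        · calc #{p ∈ n.primeFactors | p < P} ≤ #(range P) :=
                card_le_card fun p hp => by simp at hp ⊢; exact hp.2
            _ = P := card_range P

/-- `expTwoPi x = e(x) = exp (2πix)`. -/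
noncomputable def expTwoPi (x : ℝ) : ℂ := Complex.exp (Complex.I * ((2 * Real.pi * x : ℝ) : ℂ))

lemma norm_expTwoPi (x : ℝ) : ‖expTwoPi x‖ = 1 := Complex.norm_exp_I_mul_ofReal _

lemma expTwoPi_add (x y : ℝ) : expTwoPi (x + y) = expTwoPi x * expTwoPi y := by
  rw [expTwoPi, expTwoPi, expTwoPi, ← Complex.exp_add]
  congr 1
  push_cast
  ring

lemma expTwoPi_zero : expTwoPi 0 = 1 := by simp [expTwoPi]

lemma expTwoPi_nat_mul (n : ℕ) (x : ℝ) : expTwoPi (n * x) = expTwoPi x ^ n := by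
  rw [expTwoPi, expTwoPi, ← Complex.exp_nat_mul]
  congr 1
  push_cast
  ring

lemma expTwoPi_intCast (n : ℤ) : expTwoPi n = 1 := by
  rw [expTwoPi, Complex.exp_eq_one_iff]
  exact ⟨n, by push_cast; ring⟩

lemma conj_expTwoPi (x : ℝ) : (starRingEnd ℂ) (expTwoPi x) = expTwoPi (-x) := by
  rw [expTwoPi, expTwoPi, ← Complex.exp_conj, map_mul, Complex.conj_I, Complex.conj_ofReal]
  congr 1
  push_cast
  ring

lemma expTwoPi_sub_round (x : ℝ) : expTwoPi (x - round x) = expTwoPi x := by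
  conv_rhs => rw [← sub_add_cancel x (round x : ℝ), expTwoPi_add, expTwoPi_intCast, mul_one]

lemma expTwoPi_re (x : ℝ) : (expTwoPi x).re = Real.cos (2 * Real.pi * x) := by
  rw [expTwoPi, mul_comm, Complex.exp_ofReal_mul_I_re]

lemma nint_nonneg (x : ℝ) : 0 ≤ nint x := abs_nonneg _

lemma nint_le_half (x : ℝ) : nint x ≤ 1 / 2 := abs_sub_round x

lemma four_mul_nint_le_norm (x : ℝ) : 4 * nint x ≤ ‖expTwoPi x - 1‖ := by
  rw [← expTwoPi_sub_round, expTwoPi, Complex.norm_exp_I_mul_ofReal_sub_one, norm_mul,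
    Real.norm_eq_abs, Real.norm_eq_abs, abs_two, Real.abs_sin_eq_sin_abs_of_abs_le_pi]
  · have h := Real.mul_le_sin (x := Real.pi * nint x)
      (mul_nonneg Real.pi_pos.le (nint_nonneg x))
      (by have := nint_le_half x; nlinarith [Real.pi_pos])
    have h2 : |2 * Real.pi * (x - round x) / 2| = Real.pi * nint x := by
      rw [nint, show 2 * Real.pi * (x - round x) / 2 = Real.pi * (x - round x) by ring, abs_mul,
        abs_of_pos Real.pi_pos]
    rw [h2]
    have h3 : 2 / Real.pi * (Real.pi * nint x) = 2 * nint x := by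
      field_simp
    linarith
  · have h2 : |2 * Real.pi * (x - round x) / 2| = Real.pi * nint x := by
      rw [nint, show 2 * Real.pi * (x - round x) / 2 = Real.pi * (x - round x) by ring, abs_mul,
        abs_of_pos Real.pi_pos]
    rw [h2]
    have := nint_le_half x
    nlinarith [Real.pi_pos]

/-- A version of `min M (1 / nint x)` which takes the value `M` when `x` is an integer. -/
noncomputable def truncInv (M x : ℝ) : ℝ := (max M⁻¹ (nint x))⁻¹

lemma truncInv_nonneg {M : ℝ} (hM : 0 ≤ M) (x : ℝ) : 0 ≤ truncInv M x :=
  inv_nonneg.2 (le_max_of_le_left (inv_nonneg.2 hM))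

lemma norm_sum_expTwoPi_le {M : ℝ} (hM : 0 < M) {n : ℕ} (hn : n ≤ M) (x y : ℝ) :
    ‖∑ m ∈ range n, expTwoPi (m * x + y)‖ ≤ truncInv M x := by
  have hS : ∑ m ∈ range n, expTwoPi (m * x + y) = (∑ m ∈ range n, expTwoPi x ^ m) * expTwoPi y := by
    rw [sum_mul]
    exact sum_congr rfl fun m _ => by rw [expTwoPi_add, expTwoPi_nat_mul]
  rw [hS, norm_mul, norm_expTwoPi, mul_one, truncInv]
  set S := ∑ m ∈ range n, expTwoPi x ^ m with hSdef
  have h1 : ‖S‖ ≤ M := by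
    refine (norm_sum_le _ _).trans ?_
    simpa [norm_pow, norm_expTwoPi] using hn
  have h2 : ‖S‖ * nint x ≤ 1 := by
    have h3 : ‖S‖ * ‖expTwoPi x - 1‖ ≤ 2 := by
      rw [← norm_mul, hSdef, geom_sum_mul]
      refine (norm_sub_le _ _).trans ?_
      rw [norm_pow, norm_expTwoPi]
      norm_num
    have h4 := mul_le_mul_of_nonneg_left (four_mul_nint_le_norm x) (norm_nonneg S)
    have := mul_nonneg (norm_nonneg S) (nint_nonneg x)
    linarith
  have hpos : 0 < max M⁻¹ (nint x) := lt_max_of_lt_left (inv_pos.2 hM)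
  rw [← one_div, le_div_iff₀ hpos, mul_max_of_nonneg _ _ (norm_nonneg S)]
  refine max_le ?_ h2
  rw [← div_eq_mul_inv, div_le_one hM]
  exact h1

lemma norm_sum_sq_eq (z : ℕ → ℂ) (N : ℕ) :
    ‖∑ n ∈ range N, z n‖ ^ 2 = ∑ n ∈ range N, ‖z n‖ ^ 2 +
      2 * ∑ r ∈ range N,
        (∑ m ∈ range (N - 1 - r), z (m + r + 1) * (starRingEnd ℂ) (z m)).re := by
  induction N with
  | zero => simp
  | succ N ih =>
    have h1 : ∑ r ∈ range N,
        (∑ m ∈ range (N - r), z (m + r + 1) * (starRingEnd ℂ) (z m)).re =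
        ∑ r ∈ range N,
        (∑ m ∈ range (N - 1 - r), z (m + r + 1) * (starRingEnd ℂ) (z m)).re +
        (z N * (starRingEnd ℂ) (∑ n ∈ range N, z n)).re := by
      have h2 : z N * (starRingEnd ℂ) (∑ n ∈ range N, z n) =
          ∑ r ∈ range N, z N * (starRingEnd ℂ) (z (N - 1 - r)) := by
        rw [map_sum, mul_sum, ← sum_range_reflect]
      rw [h2, Complex.re_sum, ← sum_add_distrib]
      refine sum_congr rfl fun r hr => ?_
      have hr' := mem_range.1 hr
      rw [show N - r = N - 1 - r + 1 by omega, sum_range_succ, Complex.add_re,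
        show N - 1 - r + r + 1 = N by omega]
    rw [sum_range_succ, sum_range_succ, sum_range_succ, Nat.add_sub_cancel, h1, Nat.sub_self,
      range_zero, sum_empty, Complex.zero_re]
    rw [← Complex.normSq_eq_norm_sq, Complex.normSq_add, Complex.normSq_eq_norm_sq, ih,
      Complex.normSq_eq_norm_sq]
    have h3 : ((∑ n ∈ range N, z n) * (starRingEnd ℂ) (z N)).re =
        (z N * (starRingEnd ℂ) (∑ n ∈ range N, z n)).re := by
      simp only [Complex.mul_re, Complex.conj_re, Complex.conj_im]
      ring
    rw [h3]
    ring

/-- The quadratic Weyl sum `∑_{n ≤ N} e(θ n²)`. -/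
noncomputable def weylSum (N : ℕ) (θ : ℝ) : ℂ := ∑ n ∈ range N, expTwoPi (θ * ((n : ℝ) + 1) ^ 2)

lemma norm_weylSum_sq_le {N : ℕ} (hN : 0 < N) (θ : ℝ) :
    ‖weylSum N θ‖ ^ 2 ≤ N + 2 * ∑ r ∈ range N, truncInv N (2 * θ * ((r : ℝ) + 1)) := by
  rw [weylSum, norm_sum_sq_eq]
  simp only [norm_expTwoPi]
  have hN' : (0 : ℝ) < N := by exact_mod_cast hN
  gcongr with r hr
  · simp
  · refine (Complex.re_le_norm _).trans ?_
    have : ∀ m : ℕ, expTwoPi (θ * (((m + r + 1 : ℕ) : ℝ) + 1) ^ 2) *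
        (starRingEnd ℂ) (expTwoPi (θ * ((m : ℝ) + 1) ^ 2)) =
        expTwoPi (m * (2 * θ * ((r : ℝ) + 1)) + θ * (r + 1) * (r + 3)) := by
      intro m
      rw [conj_expTwoPi, ← expTwoPi_add]
      congr 1
      push_cast
      ring
    rw [sum_congr rfl fun m _ => this m]
    refine norm_sum_expTwoPi_le hN' ?_ _ _
    exact_mod_cast (by omega : N - 1 - r ≤ N)

lemma sum_norm_dirichlet_sq_le (N K : ℕ) (α β : ℝ) :
    ∑ n ∈ range N, ‖∑ k ∈ range K, expTwoPi (k * (α * ((n : ℝ) + 1) ^ 2 + β))‖ ^ 2 ≤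
      K * (N + 2 * ∑ r ∈ range K, ‖weylSum N (((r : ℝ) + 1) * α)‖) := by
  have h : ∀ n : ℕ, ‖∑ k ∈ range K, expTwoPi (k * (α * ((n : ℝ) + 1) ^ 2 + β))‖ ^ 2 =
      K + 2 * ∑ r ∈ range K, (((K - 1 - r : ℕ) : ℂ) * (expTwoPi ((r + 1) * β) *
        expTwoPi ((r + 1) * α * ((n : ℝ) + 1) ^ 2))).re := by
    intro n
    rw [norm_sum_sq_eq]
    simp only [norm_expTwoPi]
    congr 1
    · simp
    · congr 1
      refine sum_congr rfl fun r _ => ?_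
      congr 1
      rw [← expTwoPi_add, ← nsmul_eq_mul]
      conv_rhs => rw [← card_range (K - 1 - r), ← sum_const]
      refine sum_congr rfl fun m _ => ?_
      rw [conj_expTwoPi, ← expTwoPi_add]
      congr 1
      push_cast
      ring
  rw [sum_congr rfl fun n _ => h n, sum_add_distrib, ← mul_sum, sum_comm]
  have h2 : ∀ r ∈ range K, ∑ n ∈ range N, (((K - 1 - r : ℕ) : ℂ) * (expTwoPi ((r + 1) * β) *
        expTwoPi ((r + 1) * α * ((n : ℝ) + 1) ^ 2))).re ≤
        K * ‖weylSum N (((r : ℝ) + 1) * α)‖ := by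
    intro r _
    rw [← Complex.re_sum, ← mul_sum, ← mul_sum]
    refine (Complex.re_le_norm _).trans ?_
    rw [norm_mul, norm_mul, norm_expTwoPi, one_mul, Complex.norm_natCast, weylSum]
    gcongr
    omega
  have h3 := sum_le_sum h2
  rw [← mul_sum] at h3
  simp only [sum_const, card_range, nsmul_eq_mul]
  linarith

lemma half_le_norm_dirichlet {K : ℕ} {x : ℝ} (h : K * nint x ≤ 1 / 6) :
    (K : ℝ) / 2 ≤ ‖∑ k ∈ range K, expTwoPi (k * x)‖ := by
  refine le_trans ?_ (Complex.re_le_norm _)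
  rw [Complex.re_sum]
  have : ∀ k ∈ range K, (1 / 2 : ℝ) ≤ (expTwoPi (k * x)).re := by
    intro k hk
    have hk' : (k : ℝ) ≤ K := by exact_mod_cast (mem_range.1 hk).le
    rw [expTwoPi_nat_mul, ← expTwoPi_sub_round, ← expTwoPi_nat_mul, expTwoPi_re, ← Real.cos_abs,
      ← Real.cos_pi_div_three]
    have h1 : |2 * Real.pi * (k * (x - round x))| = 2 * Real.pi * (k * nint x) := by
      rw [abs_mul, abs_of_pos (by positivity : 0 < 2 * Real.pi), abs_mul, Nat.abs_cast, nint]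
    have h2 : k * nint x ≤ 1 / 6 := (mul_le_mul_of_nonneg_right hk' (nint_nonneg x)).trans h
    apply Real.cos_le_cos_of_nonneg_of_le_pi (abs_nonneg _)
    · linarith [Real.pi_pos]
    · rw [h1]
      nlinarith [Real.pi_pos]
  have h3 := sum_le_sum this
  simp only [sum_const, card_range, nsmul_eq_mul] at h3
  linarith

lemma min_one_div_le_fejer {H : ℝ} (hH : 1 ≤ H) (x : ℝ) :
    (if nint x = 0 then (1 : ℝ) else min 1 (1 / (H * nint x))) ≤
      48 / H * ∑ K ∈ range ⌊H⌋₊,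
        ‖∑ k ∈ range (K + 1), expTwoPi (k * x)‖ ^ 2 / ((K : ℝ) + 1) ^ 2 := by
  have hH0 : 0 < H := by linarith
  set S := ∑ K ∈ range ⌊H⌋₊,
        ‖∑ k ∈ range (K + 1), expTwoPi (k * x)‖ ^ 2 / ((K : ℝ) + 1) ^ 2 with hS
  have key : ∀ M : ℕ, M ≤ ⌊H⌋₊ → M * nint x ≤ 1 / 6 → (M : ℝ) / 4 ≤ S := by
    intro M hM hx
    have h1 : ∀ K ∈ range M, (1 / 4 : ℝ) ≤
        ‖∑ k ∈ range (K + 1), expTwoPi (k * x)‖ ^ 2 / ((K : ℝ) + 1) ^ 2 := by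
      intro K hK
      have hK' : ((K + 1 : ℕ) : ℝ) ≤ M := by exact_mod_cast mem_range.1 hK
      have h2 := half_le_norm_dirichlet
        ((mul_le_mul_of_nonneg_right hK' (nint_nonneg x)).trans hx)
      push_cast at h2
      rw [le_div_iff₀ (by positivity)]
      calc 1 / 4 * ((K : ℝ) + 1) ^ 2 = (((K : ℝ) + 1) / 2) ^ 2 := by ring
        _ ≤ _ := by gcongr
    calc (M : ℝ) / 4 = ∑ K ∈ range M, (1 / 4 : ℝ) := by simp; ring
      _ ≤ _ := sum_le_sum h1
      _ ≤ S := sum_le_sum_of_subset_of_nonneg (range_subset_range.2 hM) fun i _ _ => by positivity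
  have hfl : ∀ y : ℝ, 1 ≤ y → y / 2 ≤ ⌊y⌋₊ := by
    intro y hy
    have h1 := Nat.lt_floor_add_one y
    have h2 : (1 : ℝ) ≤ ⌊y⌋₊ := by exact_mod_cast (Nat.one_le_floor_iff y).2 hy
    linarith
  rw [div_mul_eq_mul_div, le_div_iff₀ hH0]
  have hterm : (if nint x = 0 then (1 : ℝ) else min 1 (1 / (H * nint x))) ≤ 1 := by
    split_ifs
    · exact le_rfl
    · exact min_le_left _ _
  by_cases h1 : 6 * nint x * H ≤ 1
  · have h2 := key ⌊H⌋₊ le_rfl (by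
      have := mul_le_mul_of_nonneg_right (Nat.floor_le hH0.le) (nint_nonneg x)
      linarith)
    have := hfl H hH
    have := mul_le_mul_of_nonneg_right hterm hH0.le
    linarith
  push Not at h1
  have hx : 0 < nint x := by
    by_contra h
    have : nint x = 0 := le_antisymm (not_lt.1 h) (nint_nonneg x)
    rw [this] at h1
    norm_num at h1
  rw [if_neg hx.ne']
  have hterm2 : min 1 (1 / (H * nint x)) * H ≤ 1 / nint x := by
    calc min 1 (1 / (H * nint x)) * H ≤ 1 / (H * nint x) * H := by
          gcongr; exact min_le_right _ _
      _ = 1 / nint x := by field_simp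
  refine hterm2.trans ?_
  by_cases h2 : 6 * nint x ≤ 1
  · have h3 : 1 ≤ 1 / (6 * nint x) := by
      rw [le_div_iff₀ (by positivity)]; linarith
    have h4 : 1 / (6 * nint x) ≤ H := by
      rw [div_le_iff₀ (by positivity)]; linarith
    have h5 := key ⌊1 / (6 * nint x)⌋₊ (Nat.floor_le_floor h4) (by
      calc (⌊1 / (6 * nint x)⌋₊ : ℝ) * nint x ≤ 1 / (6 * nint x) * nint x := by
            gcongr; exact Nat.floor_le (by positivity)
        _ = 1 / 6 := by field_simp)
    have h6 := hfl _ h3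
    have h7 : 1 / (6 * nint x) = 1 / nint x / 6 := by field_simp
    rw [h7] at h5 h6
    linarith
  · push Not at h2
    have h3 : 1 / nint x ≤ 6 := by
      rw [div_le_iff₀ hx]; linarith
    have h4 : 1 ≤ S := by
      have h5 : 0 ∈ range ⌊H⌋₊ := mem_range.2 ((Nat.one_le_floor_iff H).2 hH)
      refine le_trans ?_ (single_le_sum (fun i _ => by positivity) h5)
      simp [expTwoPi_zero]
    linarith

lemma sum_one_div_range_le (n : ℕ) :
    ∑ k ∈ range n, 1 / ((k : ℝ) + 1) ≤ 1 + Real.log n := by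
  have h := harmonic_le_one_add_log n
  rw [harmonic] at h
  push_cast at h
  simpa [one_div] using h

lemma sum_min_le_weylSum {H : ℝ} (hH : 1 ≤ H) (N : ℕ) (α β : ℝ) :
    ∑ n ∈ range N, (if nint (α * ((n : ℝ) + 1) ^ 2 + β) = 0 then (1 : ℝ)
        else min 1 (1 / (H * nint (α * ((n : ℝ) + 1) ^ 2 + β)))) ≤
      48 / H * (1 + Real.log H) *
        (N + 2 * ∑ r ∈ range ⌊H⌋₊, ‖weylSum N (((r : ℝ) + 1) * α)‖) := by
  have hH0 : 0 < H := by linarith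
  set T := ∑ r ∈ range ⌊H⌋₊, ‖weylSum N (((r : ℝ) + 1) * α)‖ with hT
  have hT0 : 0 ≤ T := sum_nonneg fun _ _ => norm_nonneg _
  refine (sum_le_sum fun n _ => min_one_div_le_fejer hH _).trans ?_
  rw [← mul_sum, sum_comm, mul_assoc]
  gcongr
  have h1 : ∀ K ∈ range ⌊H⌋₊, ∑ n ∈ range N,
      ‖∑ k ∈ range (K + 1), expTwoPi (k * (α * ((n : ℝ) + 1) ^ 2 + β))‖ ^ 2 / ((K : ℝ) + 1) ^ 2 ≤
      1 / ((K : ℝ) + 1) * (N + 2 * T) := by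
    intro K hK
    rw [← sum_div, div_le_iff₀ (by positivity)]
    refine (sum_norm_dirichlet_sq_le N (K + 1) α β).trans ?_
    have h2 : ∑ r ∈ range (K + 1), ‖weylSum N (((r : ℝ) + 1) * α)‖ ≤ T :=
      sum_le_sum_of_subset_of_nonneg (range_subset_range.2 (mem_range.1 hK))
        fun _ _ _ => norm_nonneg _
    have h3 : 1 / ((K : ℝ) + 1) * (N + 2 * T) * ((K : ℝ) + 1) ^ 2 =
        ((K + 1 : ℕ) : ℝ) * (N + 2 * T) := by
      push_cast
      field_simp
    rw [h3]
    gcongr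
  refine (sum_le_sum h1).trans ?_
  rw [← sum_mul]
  gcongr
  refine (sum_one_div_range_le _).trans ?_
  gcongr
  · exact_mod_cast (Nat.one_le_floor_iff H).2 hH
  · exact Nat.floor_le hH0.le

lemma sum_sum_le_mul_sum_of_card_divisors_le {F : ℕ → ℝ} (hF : ∀ l, 0 ≤ F l) {A B : ℕ} {D : ℝ}
    (hD : ∀ l ∈ Icc 1 (2 * A * B), (#l.divisors : ℝ) ≤ D) :
    ∑ h ∈ range A, ∑ r ∈ range B, F (2 * (h + 1) * (r + 1)) ≤
      D * ∑ l ∈ Icc 1 (2 * A * B), F l := by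
  rw [← sum_product', mul_sum]
  have hmaps : ∀ p ∈ range A ×ˢ range B, 2 * (p.1 + 1) * (p.2 + 1) ∈ Icc 1 (2 * A * B) := by
    intro p hp
    rw [mem_product, mem_range, mem_range] at hp
    rw [mem_Icc]
    refine ⟨by nlinarith, ?_⟩
    gcongr
    · exact hp.1
    · exact hp.2
  rw [← sum_fiberwise_of_maps_to hmaps]
  refine sum_le_sum fun l hl => ?_
  have h1 : ∑ p ∈ range A ×ˢ range B with 2 * (p.1 + 1) * (p.2 + 1) = l,
      F (2 * (p.1 + 1) * (p.2 + 1)) =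
      #{p ∈ range A ×ˢ range B | 2 * (p.1 + 1) * (p.2 + 1) = l} * F l := by
    rw [← nsmul_eq_mul, ← sum_const]
    exact sum_congr rfl fun p hp => by rw [(mem_filter.1 hp).2]
  rw [h1]
  refine mul_le_mul_of_nonneg_right (le_trans ?_ (hD l hl)) (hF l)
  have hl0 : l ≠ 0 := by
    have := (mem_Icc.1 hl).1
    omega
  refine Nat.cast_le.2 (card_le_card_of_injOn (fun p => p.1 + 1) ?_ ?_)
  · intro p hp
    have hp' := (mem_filter.1 hp).2
    exact Nat.mem_divisors.2 ⟨⟨2 * (p.2 + 1), by rw [← hp']; ring⟩, hl0⟩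
  · intro p hp p' hp' h
    have e := (mem_filter.1 hp).2
    have e' := (mem_filter.1 hp').2
    have h' : p.1 + 1 = p'.1 + 1 := h
    rw [← e', h'] at e
    have h2 := Nat.eq_of_mul_eq_mul_left (by positivity) e
    exact Prod.ext (by omega) (by omega)

lemma card_floor_mul_fract_eq_le {α : ℝ} {a : ℤ} {q : ℕ} (hq : 0 < q) (haq : IsCoprime a (q : ℤ))
    (hα : |α - (a : ℝ) / (q : ℝ)| < 1 / (q : ℝ) ^ 2) (b j : ℕ) :
    #{i ∈ range q | ⌊q * Int.fract (((b + i : ℕ) : ℝ) * α)⌋₊ = j} ≤ 3 := by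
  have hq' : (0 : ℝ) < q := by exact_mod_cast hq
  set s := {i ∈ range q | ⌊q * Int.fract (((b + i : ℕ) : ℝ) * α)⌋₊ = j} with hs
  rcases s.eq_empty_or_nonempty with h0 | ⟨i₀, hi₀⟩
  · simp [h0]
  have key : ∀ i ∈ s, (((i : ℤ) - i₀) * a : ZMod q) ∈ ({-1, 0, 1} : Finset (ZMod q)) := by
    intro i hi
    rw [hs, mem_filter, mem_range] at hi hi₀
    obtain ⟨hi1, hi2⟩ := hi
    obtain ⟨hj1, hj2⟩ := hi₀
    set x := ((b + i : ℕ) : ℝ) * α with hx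
    set y := ((b + i₀ : ℕ) : ℝ) * α with hy
    have hx1 := (Nat.floor_eq_iff (mul_nonneg hq'.le (Int.fract_nonneg x))).1 hi2
    have hy1 := (Nat.floor_eq_iff (mul_nonneg hq'.le (Int.fract_nonneg y))).1 hj2
    have hxf := Int.fract_add_floor x
    have hyf := Int.fract_add_floor y
    set c : ℤ := ⌊x⌋ - ⌊y⌋ with hc
    set d : ℤ := (i : ℤ) - i₀ with hd
    have hdr : (d : ℝ) = i - i₀ := by rw [hd]; push_cast; ring
    have h1 : |(d : ℝ) * α * q - c * q| < 1 := by
      have : (d : ℝ) * α * q - c * q = q * Int.fract x - q * Int.fract y := by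
        have e1 : (d : ℝ) * α = x - y := by rw [hdr, hx, hy]; push_cast; ring
        have e2 : (c : ℝ) = ⌊x⌋ - ⌊y⌋ := by rw [hc]; push_cast; ring
        rw [e1, e2]
        linear_combination (-(q : ℝ)) * hxf + (q : ℝ) * hyf
      rw [this, abs_lt]
      constructor <;> linarith [hx1.1, hx1.2, hy1.1, hy1.2]
    have h2 : |(d : ℝ)| ≤ q := by
      have e1 : (i : ℝ) < q := by exact_mod_cast hi1
      have e2 : (i₀ : ℝ) < q := by exact_mod_cast hj1
      have e3 : (0 : ℝ) ≤ i := Nat.cast_nonneg _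
      have e4 : (0 : ℝ) ≤ i₀ := Nat.cast_nonneg _
      rw [hdr, abs_le]
      constructor <;> linarith
    have h3 : |(d : ℝ) * q * (α - a / q)| ≤ 1 := by
      rw [abs_mul, abs_mul, Nat.abs_cast]
      calc |(d : ℝ)| * q * |α - a / q| ≤ q * q * (1 / (q : ℝ) ^ 2) := by gcongr
        _ = 1 := by field_simp
    have h4 : |((d * a - c * q : ℤ) : ℝ)| < 2 := by
      have : ((d * a - c * q : ℤ) : ℝ) = ((d : ℝ) * α * q - c * q) - (d : ℝ) * q * (α - a / q) := by
        push_cast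
        field_simp
        ring
      rw [this]
      exact (abs_sub _ _).trans_lt (by linarith)
    have h5 : |d * a - c * q| < 2 := by exact_mod_cast h4
    have h6 : ((d * a : ℤ) : ZMod q) = ((d * a - c * q : ℤ) : ZMod q) := by
      push_cast
      simp
    have h7 : (((i : ℤ) - i₀) * a : ZMod q) = ((d * a : ℤ) : ZMod q) := by
      rw [hd]; push_cast; ring
    rw [h7, h6]
    rw [abs_lt] at h5
    obtain h | h | h : d * a - c * q = -1 ∨ d * a - c * q = 0 ∨ d * a - c * q = 1 := by omega
    all_goals rw [h]; simp
  calc #s ≤ #({-1, 0, 1} : Finset (ZMod q)) := by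
        refine card_le_card_of_injOn (fun i => (((i : ℤ) - i₀) * a : ZMod q)) key ?_
        intro i hi i' hi' h
        obtain ⟨u, v, huv⟩ := haq
        have huv' : ((u * a + v * q : ℤ) : ZMod q) = 1 := by rw [huv]; simp
        push_cast at huv'
        simp only [CharP.cast_eq_zero, mul_zero, add_zero] at huv'
        have h' : (((i : ℤ) - i₀) * a : ZMod q) = ((i' : ℤ) - i₀) * a := h
        push_cast at h'
        have h8 : (i : ZMod q) = i' := by
          linear_combination (u : ZMod q) * h' + ((i' : ZMod q) - i) * huv'
        have h9 := (ZMod.natCast_eq_natCast_iff' _ _ _).1 h8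
        rwa [Nat.mod_eq_of_lt (mem_range.1 (mem_filter.1 hi).1),
          Nat.mod_eq_of_lt (mem_range.1 (mem_filter.1 hi').1)] at h9
    _ ≤ 3 := card_le_three

lemma truncInv_le_of_floor_eq {M x : ℝ} (hM : 0 < M) {q j : ℕ} (hq : 0 < q)
    (h : ⌊q * Int.fract x⌋₊ = j) :
    truncInv M x ≤ (max M⁻¹ ((j : ℝ) / q))⁻¹ + (max M⁻¹ (((q - 1 - j : ℕ) : ℝ) / q))⁻¹ := by
  have hq' : (0 : ℝ) < q := by exact_mod_cast hq
  obtain ⟨h1, h2⟩ := (Nat.floor_eq_iff (mul_nonneg hq'.le (Int.fract_nonneg x))).1 h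
  have hM' : 0 < M⁻¹ := inv_pos.2 hM
  have hp : ∀ y : ℝ, 0 < max M⁻¹ y := fun y => lt_max_of_lt_left hM'
  have hj : j < q := by
    have : (j : ℝ) < q := h1.trans_lt (by nlinarith [Int.fract_lt_one x])
    exact_mod_cast this
  rw [truncInv, nint, abs_sub_round_eq_min]
  rcases min_choice (Int.fract x) (1 - Int.fract x) with h3 | h3 <;> rw [h3]
  · refine le_add_of_le_of_nonneg (inv_anti₀ (hp _) (max_le_max le_rfl ?_)) (inv_pos.2 (hp _)).le
    rw [div_le_iff₀ hq']
    linarith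
  · refine le_add_of_nonneg_of_le (inv_pos.2 (hp _)).le (inv_anti₀ (hp _) (max_le_max le_rfl ?_))
    rw [div_le_iff₀ hq', Nat.cast_sub (by omega), Nat.cast_sub (by omega)]
    push_cast
    linarith

lemma sum_inv_max_le {M : ℝ} (hM : 0 < M) (q : ℕ) :
    ∑ j ∈ range q, (max M⁻¹ ((j : ℝ) / q))⁻¹ ≤ M + q * (1 + Real.log q) := by
  cases q with
  | zero => simpa using hM.le
  | succ n =>
    rw [sum_range_succ']
    have h0 : (max M⁻¹ (((0 : ℕ) : ℝ) / ((n + 1 : ℕ) : ℝ)))⁻¹ = M := by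
      rw [Nat.cast_zero, zero_div, max_eq_left (inv_pos.2 hM).le, inv_inv]
    rw [h0, add_comm M]
    gcongr
    calc ∑ k ∈ range n, (max M⁻¹ (((k + 1 : ℕ) : ℝ) / ((n + 1 : ℕ) : ℝ)))⁻¹
        ≤ ∑ k ∈ range n, ((n + 1 : ℕ) : ℝ) * (1 / ((k : ℝ) + 1)) := by
          refine sum_le_sum fun k _ => ?_
          calc _ ≤ ((((k + 1 : ℕ) : ℝ) / ((n + 1 : ℕ) : ℝ)))⁻¹ :=
                inv_anti₀ (by positivity) (le_max_right _ _)
            _ = _ := by push_cast; field_simp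
      _ ≤ ((n + 1 : ℕ) : ℝ) * ∑ k ∈ range (n + 1), 1 / ((k : ℝ) + 1) := by
          rw [← mul_sum]
          gcongr
          exact Nat.le_succ n
      _ ≤ _ := by
          gcongr
          exact sum_one_div_range_le _

lemma sum_truncInv_block_le {α : ℝ} {a : ℤ} {q : ℕ} (hq : 0 < q) (haq : IsCoprime a (q : ℤ))
    (hα : |α - (a : ℝ) / (q : ℝ)| < 1 / (q : ℝ) ^ 2) {M : ℝ} (hM : 0 < M) (b : ℕ) :
    ∑ i ∈ range q, truncInv M (((b + i : ℕ) : ℝ) * α) ≤ 6 * (M + q * (1 + Real.log q)) := by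
  have hq' : (0 : ℝ) < q := by exact_mod_cast hq
  set u : ℕ → ℝ := fun j => (max M⁻¹ ((j : ℝ) / q))⁻¹ with hu
  have hu0 : ∀ j, 0 ≤ u j := fun j =>
    inv_nonneg.2 (le_max_of_le_left (inv_pos.2 hM).le)
  have hmaps : ∀ i ∈ range q, ⌊q * Int.fract (((b + i : ℕ) : ℝ) * α)⌋₊ ∈ range q := by
    intro i _
    rw [mem_range, Nat.floor_lt (mul_nonneg hq'.le (Int.fract_nonneg _))]
    nlinarith [Int.fract_lt_one (((b + i : ℕ) : ℝ) * α)]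
  rw [← sum_fiberwise_of_maps_to hmaps]
  have h1 : ∀ j ∈ range q, ∑ i ∈ range q with ⌊q * Int.fract (((b + i : ℕ) : ℝ) * α)⌋₊ = j,
      truncInv M (((b + i : ℕ) : ℝ) * α) ≤ 3 * (u j + u (q - 1 - j)) := by
    intro j _
    refine (sum_le_card_nsmul _ _ (u j + u (q - 1 - j)) fun i hi =>
      truncInv_le_of_floor_eq hM hq (mem_filter.1 hi).2).trans ?_
    rw [nsmul_eq_mul]
    refine mul_le_mul_of_nonneg_right ?_ (add_nonneg (hu0 _) (hu0 _))
    exact_mod_cast card_floor_mul_fract_eq_le hq haq hα b j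
  refine (sum_le_sum h1).trans ?_
  rw [← mul_sum, sum_add_distrib, sum_range_reflect]
  have := sum_inv_max_le hM q
  linarith

lemma sum_truncInv_le {α : ℝ} {a : ℤ} {q : ℕ} (hq : 0 < q) (haq : IsCoprime a (q : ℤ))
    (hα : |α - (a : ℝ) / (q : ℝ)| < 1 / (q : ℝ) ^ 2) {M : ℝ} (hM : 0 < M) (L : ℕ) :
    ∑ l ∈ Icc 1 L, truncInv M ((l : ℝ) * α) ≤
      ((L : ℝ) / q + 1) * (6 * (M + q * (1 + Real.log q))) := by
  have hblocks : ∀ k : ℕ, ∑ l ∈ range (k * q), truncInv M (((1 + l : ℕ) : ℝ) * α) ≤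
      k * (6 * (M + q * (1 + Real.log q))) := by
    intro k
    induction k with
    | zero => simp
    | succ k ih =>
      rw [Nat.succ_mul, sum_range_add]
      have := sum_truncInv_block_le hq haq hα hM (1 + k * q)
      simp only [← add_assoc]
      push_cast at *
      linarith
  have hlog : 0 ≤ Real.log q := Real.log_natCast_nonneg q
  calc ∑ l ∈ Icc 1 L, truncInv M ((l : ℝ) * α)
      = ∑ l ∈ range L, truncInv M (((1 + l : ℕ) : ℝ) * α) := by
        rw [← Ico_add_one_right_eq_Icc, sum_Ico_eq_sum_range, Nat.add_sub_cancel]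
    _ ≤ ∑ l ∈ range ((L / q + 1) * q), truncInv M (((1 + l : ℕ) : ℝ) * α) := by
        refine sum_le_sum_of_subset_of_nonneg (range_subset_range.2 ?_)
          fun _ _ _ => truncInv_nonneg hM.le _
        rw [mul_comm]
        exact (Nat.lt_mul_div_succ L hq).le
    _ ≤ ((L / q + 1 : ℕ) : ℝ) * (6 * (M + q * (1 + Real.log q))) := hblocks _
    _ ≤ _ := by
        gcongr
        push_cast
        gcongr
        exact Nat.cast_div_le

lemma sum_norm_weylSum_sq_le {α : ℝ} {a : ℤ} {q : ℕ} (hq : 0 < q) (haq : IsCoprime a (q : ℤ))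
    (hα : |α - (a : ℝ) / (q : ℝ)| < 1 / (q : ℝ) ^ 2) {A B : ℕ} (hB : 0 < B) {D : ℝ} (hD0 : 0 ≤ D)
    (hD : ∀ l ∈ Icc 1 (2 * A * B), (#l.divisors : ℝ) ≤ D) :
    (∑ h ∈ range A, ‖weylSum B (((h : ℝ) + 1) * α)‖) ^ 2 ≤
      A * (A * B + 2 * (D * ((2 * A * B / q + 1) * (6 * (B + q * (1 + Real.log q)))))) := by
  have hB' : (0 : ℝ) < B := by exact_mod_cast hB
  refine sq_sum_le_card_mul_sum_sq.trans ?_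
  rw [card_range]
  gcongr
  refine (sum_le_sum fun h _ => norm_weylSum_sq_le hB _).trans ?_
  rw [sum_add_distrib, ← mul_sum, sum_const, card_range, nsmul_eq_mul]
  gcongr
  have h1 := sum_sum_le_mul_sum_of_card_divisors_le
    (F := fun l => truncInv B ((l : ℝ) * α)) (fun l => truncInv_nonneg hB'.le _) hD
  have h2 := sum_truncInv_le hq haq hα hB' (2 * A * B)
  calc _ = ∑ h ∈ range A, ∑ r ∈ range B, truncInv B (((2 * (h + 1) * (r + 1) : ℕ) : ℝ) * α) := by
        refine sum_congr rfl fun h _ => sum_congr rfl fun r _ => ?_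
        congr 1
        push_cast
        ring
    _ ≤ _ := h1
    _ ≤ _ := by
        push_cast at h2
        gcongr

lemma one_add_log_le {η x : ℝ} (hη : 0 < η) (hx : 1 ≤ x) :
    1 + Real.log x ≤ (1 + 1 / η) * x ^ η := by
  have h1 := Real.log_le_rpow_div (by linarith : 0 ≤ x) hη
  have h2 := Real.one_le_rpow hx hη.le
  have h3 : (1 + 1 / η) * x ^ η = x ^ η + x ^ η / η := by ring
  linarith

lemma weyl_bound_le {H N q P T : ℝ} (hH : 1 ≤ H) (hN : 1 ≤ N) (hq : 1 ≤ q) (hP : 1 ≤ P)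
    (hT : T ^ 2 ≤ H * (H * N + 2 * (P * ((2 * H * N / q + 1) * (6 * (N + q * P)))))) :
    T ≤ 7 * P * H * (N * q ^ (-(1 : ℝ) / 2) + N ^ ((1 : ℝ) / 2) +
      H ^ (-(1 : ℝ) / 2) * q ^ ((1 : ℝ) / 2)) := by
  have hH0 : 0 < H := by linarith
  have hN0 : 0 < N := by linarith
  have hq0 : 0 < q := by linarith
  have hneg : ∀ x : ℝ, 0 < x → (x ^ (-(1 : ℝ) / 2)) ^ 2 = 1 / x := by
    intro x hx
    rw [← Real.rpow_natCast, ← Real.rpow_mul hx.le]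
    norm_num [Real.rpow_neg_one]
  have hpos : ∀ x : ℝ, 0 < x → (x ^ ((1 : ℝ) / 2)) ^ 2 = x := by
    intro x hx
    rw [← Real.rpow_natCast, ← Real.rpow_mul hx.le]
    norm_num
  set y₁ := N * q ^ (-(1 : ℝ) / 2) with hy₁
  set y₂ := N ^ ((1 : ℝ) / 2) with hy₂
  set y₃ := H ^ (-(1 : ℝ) / 2) * q ^ ((1 : ℝ) / 2) with hy₃
  have e₁ : y₁ ^ 2 = N ^ 2 / q := by rw [hy₁, mul_pow, hneg q hq0]; ring
  have e₂ : y₂ ^ 2 = N := hpos N hN0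
  have e₃ : y₃ ^ 2 = q / H := by rw [hy₃, mul_pow, hneg H hH0, hpos q hq0]; ring
  have p₁ : 0 ≤ y₁ := by positivity
  have p₂ : 0 ≤ y₂ := by positivity
  have p₃ : 0 ≤ y₃ := by positivity
  refine le_of_abs_le (abs_le_of_sq_le_sq ?_ (by positivity))
  calc T ^ 2 ≤ H * (H * N + 2 * (P * ((2 * H * N / q + 1) * (6 * (N + q * P))))) := hT
    _ ≤ H * (P ^ 2 * (H * N) + 2 * (P * ((2 * H * N / q + 1) * (6 * (P * N + q * P))))) := by
        refine mul_le_mul_of_nonneg_left (add_le_add ?_ ?_) hH0.le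
        · exact le_mul_of_one_le_left (by positivity) (one_le_pow₀ hP)
        · gcongr
          exact le_mul_of_one_le_left hN0.le hP
    _ = P ^ 2 * H * (24 * H * (N ^ 2 / q) + 25 * (H * N) + 12 * (1 * N) + 12 * q) := by
        field_simp
        ring
    _ ≤ P ^ 2 * H * (24 * H * (N ^ 2 / q) + 25 * (H * N) + 12 * (H * N) + 12 * q) := by gcongr
    _ = (P * H) ^ 2 * (24 * y₁ ^ 2 + 37 * y₂ ^ 2 + 12 * y₃ ^ 2) := by
        rw [e₁, e₂, e₃]
        field_simp
        ring
    _ ≤ (P * H) ^ 2 * (49 * (y₁ + y₂ + y₃) ^ 2) := by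
        gcongr
        nlinarith [mul_nonneg p₁ p₂, mul_nonneg p₁ p₃, mul_nonneg p₂ p₃, sq_nonneg y₁,
          sq_nonneg y₂, sq_nonneg y₃]
    _ = _ := by ring

theorem sum_min_one_div_bound (ε : ℝ) (hε : 0 < ε) :
    ∃ C > 0, ∀ (H N α β : ℝ) (a q : ℤ), 1 ≤ H → 1 ≤ N → 1 ≤ q →
      Int.gcd a q = 1 → |α - (a : ℝ) / (q : ℝ)| < 1 / (q : ℝ) ^ 2 →
      ∑ n ∈ Finset.Icc 1 ⌊N⌋₊,
        (if nint (α * (n : ℝ) ^ 2 + β) = 0 then (1 : ℝ)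
         else min 1 (1 / (H * nint (α * (n : ℝ) ^ 2 + β)))) ≤
      C * (N * H * (q : ℝ)) ^ ε *
        (N * (q : ℝ) ^ (-(1 : ℝ) / 2) + N ^ ((1 : ℝ) / 2) + N / H +
          H ^ (-(1 : ℝ) / 2) * (q : ℝ) ^ ((1 : ℝ) / 2)) := by
  have hη : 0 < ε / 2 := by positivity
  obtain ⟨C₁, hC₁, hdiv⟩ := card_divisors_le_mul_rpow hη
  set C₂ : ℝ := max (C₁ * 2 ^ (ε / 2)) (1 + 1 / (ε / 2)) with hC₂
  have hC₂1 : 1 ≤ C₂ := le_max_of_le_right (by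
    have : 0 < 1 / (ε / 2) := by positivity
    linarith)
  refine ⟨672 * C₂ ^ 2, by positivity, ?_⟩
  intro H N α β a q' hH hN hq haq hα
  lift q' to ℕ using by omega with q
  have hq0 : 0 < q := by omega
  have hq1 : (1 : ℝ) ≤ q := by exact_mod_cast hq0
  rw [Int.cast_natCast] at hα ⊢
  have hcop : IsCoprime a (q : ℤ) := Int.isCoprime_iff_gcd_eq_one.2 haq
  have hH0 : 0 < H := by linarith
  have hN0 : 0 < N := by linarith
  set X : ℝ := N * H * q with hX
  have hHX : H ≤ X := by
    calc H = 1 * H * 1 := by ring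
      _ ≤ N * H * q := by gcongr
  have hqX : (q : ℝ) ≤ X := by
    calc (q : ℝ) = 1 * 1 * q := by ring
      _ ≤ N * H * q := by gcongr
  have hNHX : N * H ≤ X := le_mul_of_one_le_right (by positivity) hq1
  have hX1 : 1 ≤ X := hH.trans hHX
  set P : ℝ := C₂ * X ^ (ε / 2) with hP
  have hP1 : 1 ≤ P := one_le_mul_of_one_le_of_one_le hC₂1 (Real.one_le_rpow hX1 hη.le)
  have hlog : ∀ y : ℝ, 1 ≤ y → y ≤ X → 1 + Real.log y ≤ P := by
    intro y hy hyX
    refine (one_add_log_le hη hy).trans ?_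
    have h1 : (1 + 1 / (ε / 2)) ≤ C₂ := le_max_right _ _
    rw [hP]
    gcongr
  have hA : (⌊H⌋₊ : ℝ) ≤ H := Nat.floor_le hH0.le
  have hB : (⌊N⌋₊ : ℝ) ≤ N := Nat.floor_le hN0.le
  have hB0 : 0 < ⌊N⌋₊ := (Nat.one_le_floor_iff N).2 hN
  have hD : ∀ l ∈ Icc 1 (2 * ⌊H⌋₊ * ⌊N⌋₊), (#l.divisors : ℝ) ≤ P := by
    intro l hl
    rw [mem_Icc] at hl
    have hl2 : (l : ℝ) ≤ 2 * X := by
      calc (l : ℝ) ≤ 2 * ⌊H⌋₊ * ⌊N⌋₊ := by exact_mod_cast hl.2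
        _ ≤ 2 * H * N := by gcongr
        _ = 2 * (N * H) := by ring
        _ ≤ _ := by gcongr
    calc (#l.divisors : ℝ) ≤ C₁ * (l : ℝ) ^ (ε / 2) := hdiv l (by omega)
      _ ≤ C₁ * (2 * X) ^ (ε / 2) := by gcongr
      _ = C₁ * 2 ^ (ε / 2) * X ^ (ε / 2) := by
          rw [Real.mul_rpow (by norm_num) (by linarith)]; ring
      _ ≤ P := by
          rw [hP]
          gcongr
          exact le_max_left _ _
  have hsum := sum_norm_weylSum_sq_le hq0 hcop hα hB0 (by linarith : 0 ≤ P) hD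
  set T := ∑ h ∈ range ⌊H⌋₊, ‖weylSum ⌊N⌋₊ (((h : ℝ) + 1) * α)‖ with hT
  have hlogq : 0 ≤ Real.log q := Real.log_natCast_nonneg q
  have hT2 : T ^ 2 ≤ H * (H * N + 2 * (P * ((2 * H * N / q + 1) * (6 * (N + q * P))))) := by
    refine hsum.trans ?_
    have := hlog q hq1 hqX
    gcongr
  have hTle := weyl_bound_le hH hN hq1 hP1 hT2
  have hmain := sum_min_le_weylSum hH ⌊N⌋₊ α β
  rw [← hT] at hmain
  set Y := N * (q : ℝ) ^ (-(1 : ℝ) / 2) + N ^ ((1 : ℝ) / 2) +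
      H ^ (-(1 : ℝ) / 2) * (q : ℝ) ^ ((1 : ℝ) / 2) with hY
  have hY0 : 0 ≤ Y := by positivity
  have hT0 : 0 ≤ T := sum_nonneg fun _ _ => norm_nonneg _
  have hPX : P ^ 2 = C₂ ^ 2 * X ^ ε := by
    rw [hP, mul_pow, ← Real.rpow_natCast (X ^ (ε / 2)), ← Real.rpow_mul (by linarith)]
    congr 2
    push_cast
    ring
  calc _ = ∑ n ∈ range ⌊N⌋₊, (if nint (α * ((n : ℝ) + 1) ^ 2 + β) = 0 then (1 : ℝ)
        else min 1 (1 / (H * nint (α * ((n : ℝ) + 1) ^ 2 + β)))) := by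
        rw [← Ico_add_one_right_eq_Icc, sum_Ico_eq_sum_range, Nat.add_sub_cancel]
        refine sum_congr rfl fun n _ => ?_
        push_cast
        rw [add_comm (1 : ℝ) n]
    _ ≤ _ := hmain
    _ ≤ 48 / H * P * (P * N + 2 * (7 * P * H * Y)) := by
        have h1 := hlog H hH hHX
        have h2 : (⌊N⌋₊ : ℝ) ≤ P * N := hB.trans (le_mul_of_one_le_left hN0.le hP1)
        gcongr
    _ = P ^ 2 * (48 * (N / H) + 672 * Y) := by
        field_simp
        ring
    _ ≤ P ^ 2 * (672 * (N / H) + 672 * Y) := by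
        gcongr
        norm_num
    _ = _ := by
        rw [hPX, hY]
        ring
end

section
/- Let a < b be real numbers, let a(n) be complex numbers defined for integers n with a < n ≤ b, and let Q be a positive integer. Then |Σ_{a < n ≤ b} a(n)|² ≤ (1 + (b−a)/Q) Σ_{|q| ≤ Q} (1 − |q|/Q) Σ_{a < n, n+q ≤ b} a(n+q) · conj(a(n)), where the outer sum on the right is over integers q with |q| ≤ Q. -/
/-- A sum over a shifted interval of a function supported on `(A, B]`. -/
theorem sum_Ioc_shift_of_support {M : Type*} [AddCommMonoid M] (A B : ℤ) (Q q : ℤ)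
    (hq : q ∈ Finset.Icc 1 Q) (f : ℤ → M) (hf : ∀ n ∉ Finset.Ioc A B, f n = 0) :
    ∑ m ∈ Finset.Ioc (A - Q) (B - 1), f (m + q) = ∑ n ∈ Finset.Ioc A B, f n := by
  rw [Finset.mem_Icc] at hq
  symm
  refine Finset.sum_of_injOn (fun n => n - q) (fun x _ y _ h => by simpa using h) ?_ ?_ ?_
  · intro n hn
    simp only [Finset.coe_Ioc, Set.mem_Ioc] at hn ⊢
    omega
  · intro m _ hm
    refine hf _ fun h => hm ⟨m + q, by simpa using h, by simp⟩
  · intro n _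
    simp

/-- Grouping a double sum of `S (i - j)` by the value of the difference. -/
theorem sum_sum_sub_eq_sum_Icc (Q : ℕ) (S : ℤ → ℂ) :
    ∑ i ∈ Finset.Icc (1 : ℤ) Q, ∑ j ∈ Finset.Icc (1 : ℤ) Q, S (i - j) =
      ∑ q ∈ Finset.Icc (-(Q : ℤ)) Q, (((Q : ℝ) - |(q : ℝ)| : ℝ) : ℂ) * S q := by
  rw [← Finset.sum_product', ← Finset.sum_fiberwise_of_maps_to
    (t := Finset.Icc (-(Q : ℤ)) Q) (g := fun p : ℤ × ℤ => p.1 - p.2)]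
  · refine Finset.sum_congr rfl fun q hq => ?_
    rw [Finset.mem_Icc] at hq
    rw [Finset.sum_congr rfl (g := fun _ => S q)
      fun p hp => by rw [(Finset.mem_filter.mp hp).2], Finset.sum_const, nsmul_eq_mul]
    congr 1
    have hcard : (Finset.filter (fun p : ℤ × ℤ => p.1 - p.2 = q)
        (Finset.Icc (1 : ℤ) Q ×ˢ Finset.Icc (1 : ℤ) Q)).card =
        (Finset.Icc (max 1 (1 - q)) (min Q (Q - q))).card := by
      refine Finset.card_nbij' (fun p => p.2) (fun j => (j + q, j)) ?_ ?_ ?_ ?_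
      · rintro ⟨i, j⟩ h
        simp at h ⊢
        omega
      · intro j h
        simp at h ⊢
        omega
      · rintro ⟨i, j⟩ h
        simp at h ⊢
        omega
      · intro j _
        rfl
    have hint : ((Finset.Icc (max 1 (1 - q)) (min Q (Q - q))).card : ℤ) = Q - |q| := by
      rw [Int.card_Icc]
      rcases abs_cases q with h | h <;> omega
    have hreal : ((Finset.Icc (max 1 (1 - q)) (min (Q : ℤ) (Q - q))).card : ℝ) =
        Q - |(q : ℝ)| := by
      exact_mod_cast hint
    rw [hcard, ← hreal, Complex.ofReal_natCast]
  · rintro ⟨i, j⟩ h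
    simp at h ⊢
    omega

/-- The mean square of the window sums of `c`, expressed through its autocorrelations. -/
theorem sum_norm_sq_window_eq (A B : ℤ) (c : ℤ → ℂ) (Q : ℕ)
    (hc : ∀ n ∉ Finset.Ioc A B, c n = 0) :
    ((∑ m ∈ Finset.Ioc (A - Q) (B - 1), ‖∑ q ∈ Finset.Icc (1 : ℤ) Q, c (m + q)‖ ^ 2 : ℝ) : ℂ) =
      ∑ q ∈ Finset.Icc (-(Q : ℤ)) Q, (((Q : ℝ) - |(q : ℝ)| : ℝ) : ℂ) *
        ∑ n ∈ Finset.Ioc A B, c (n + q) * (starRingEnd ℂ) (c n) := by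
  rw [← sum_sum_sub_eq_sum_Icc Q
    (fun q => ∑ n ∈ Finset.Ioc A B, c (n + q) * (starRingEnd ℂ) (c n))]
  push_cast
  simp_rw [← Complex.mul_conj', map_sum, Finset.sum_mul_sum]
  rw [Finset.sum_comm]
  refine Finset.sum_congr rfl fun i _ => ?_
  rw [Finset.sum_comm]
  refine Finset.sum_congr rfl fun j hj => ?_
  rw [← sum_Ioc_shift_of_support A B Q j hj _ fun n hn => by simp [hc n hn]]
  refine Finset.sum_congr rfl fun m _ => ?_
  rw [show m + j + (i - j) = m + i by ring]

/-- Cauchy–Schwarz for the window sums of `c`. -/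
theorem sq_mul_norm_sum_sq_le (A B : ℤ) (hAB : A ≤ B) (c : ℤ → ℂ) (Q : ℕ) (hQ : 0 < Q)
    (hc : ∀ n ∉ Finset.Ioc A B, c n = 0) :
    (Q : ℝ) ^ 2 * ‖∑ n ∈ Finset.Ioc A B, c n‖ ^ 2 ≤ ((B : ℝ) - A + Q - 1) *
      ∑ m ∈ Finset.Ioc (A - Q) (B - 1), ‖∑ q ∈ Finset.Icc (1 : ℤ) Q, c (m + q)‖ ^ 2 := by
  have hsum : ∑ m ∈ Finset.Ioc (A - Q) (B - 1), ∑ q ∈ Finset.Icc (1 : ℤ) Q, c (m + q) =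
      Q * ∑ n ∈ Finset.Ioc A B, c n := by
    rw [Finset.sum_comm,
      Finset.sum_congr rfl fun q hq => sum_Ioc_shift_of_support A B Q q hq c hc]
    simp
  have hcard : ((Finset.Ioc (A - Q) (B - 1)).card : ℝ) = (B : ℝ) - A + Q - 1 := by
    have h : ((Finset.Ioc (A - Q) (B - 1)).card : ℤ) = B - A + Q - 1 := by
      rw [Int.card_Ioc]
      omega
    exact_mod_cast h
  calc (Q : ℝ) ^ 2 * ‖∑ n ∈ Finset.Ioc A B, c n‖ ^ 2
      = ‖∑ m ∈ Finset.Ioc (A - Q) (B - 1), ∑ q ∈ Finset.Icc (1 : ℤ) Q, c (m + q)‖ ^ 2 := by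
        rw [hsum, norm_mul, Complex.norm_natCast, mul_pow]
    _ ≤ (∑ m ∈ Finset.Ioc (A - Q) (B - 1), ‖∑ q ∈ Finset.Icc (1 : ℤ) Q, c (m + q)‖) ^ 2 := by
        gcongr
        exact norm_sum_le _ _
    _ ≤ _ := by
        rw [← hcard]
        exact sq_sum_le_card_mul_sum_sq

open Classical in
theorem weyl_van_der_corput (a b : ℝ) (hab : a < b) (c : ℤ → ℂ) (Q : ℕ) (hQ : 0 < Q)
    (hc : ∀ n : ℤ, ((n : ℝ) ≤ a ∨ b < (n : ℝ)) → c n = 0) :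
    ‖∑ n ∈ Finset.Ioc ⌊a⌋ ⌊b⌋, c n‖ ^ 2 ≤
      (1 + (b - a) / (Q : ℝ)) *
        (∑ q ∈ Finset.Icc (-(Q : ℤ)) (Q : ℤ),
          ((1 - |(q : ℝ)| / (Q : ℝ) : ℝ) : ℂ) *
            ∑ n ∈ (Finset.Ioc ⌊a⌋ ⌊b⌋).filter (fun n => ((n + q : ℤ) : ℝ) ≤ b),
              c (n + q) * (starRingEnd ℂ) (c n)).re := by
  have hsupp : ∀ n ∉ Finset.Ioc ⌊a⌋ ⌊b⌋, c n = 0 := by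
    intro n hn
    apply hc
    rw [← Int.le_floor, ← Int.floor_lt]
    rw [Finset.mem_Ioc] at hn
    omega
  have hQ' : (0 : ℝ) < Q := by exact_mod_cast hQ
  set R : ℝ := ∑ m ∈ Finset.Ioc (⌊a⌋ - Q) (⌊b⌋ - 1),
    ‖∑ q ∈ Finset.Icc (1 : ℤ) Q, c (m + q)‖ ^ 2 with hR
  have hR0 : 0 ≤ R := Finset.sum_nonneg fun _ _ => by positivity
  have hcorr : ∑ q ∈ Finset.Icc (-(Q : ℤ)) (Q : ℤ),
      ((1 - |(q : ℝ)| / (Q : ℝ) : ℝ) : ℂ) *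
        ∑ n ∈ (Finset.Ioc ⌊a⌋ ⌊b⌋).filter (fun n => ((n + q : ℤ) : ℝ) ≤ b),
          c (n + q) * (starRingEnd ℂ) (c n) = ((R / Q : ℝ) : ℂ) := by
    rw [Complex.ofReal_div, hR, sum_norm_sq_window_eq _ _ c Q hsupp, Finset.sum_div]
    refine Finset.sum_congr rfl fun q _ => ?_
    rw [Finset.sum_filter_of_ne]
    · rw [mul_div_right_comm, ← Complex.ofReal_div, sub_div, div_self hQ'.ne']
    · intro n _ hne
      by_contra h
      exact hne (by rw [hc (n + q) (Or.inr (not_le.mp h)), zero_mul])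
  rw [hcorr, Complex.ofReal_re]
  have hmain := sq_mul_norm_sum_sq_le ⌊a⌋ ⌊b⌋ (Int.floor_mono hab.le) c Q hQ hsupp
  rw [← hR] at hmain
  have hlen : (⌊b⌋ : ℝ) - ⌊a⌋ + Q - 1 ≤ Q + (b - a) := by
    linarith [Int.floor_le b, Int.lt_floor_add_one a]
  have hle := hmain.trans (mul_le_mul_of_nonneg_right hlen hR0)
  have heq : (1 + (b - a) / (Q : ℝ)) * (R / Q) = (Q + (b - a)) * R / (Q : ℝ) ^ 2 := by
    field_simp
  rw [heq, le_div_iff₀ (by positivity), mul_comm]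
  exact hle
end
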